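/- For every n ≥ 2: each Demazure operator ∂_i is a well-defined ℤ-linear endomorphism of P = ℤ[x_1,…,x_n] (i.e., x_{i+1} − x_i divides x_{i+1}·(f − σ_i(f)) for every polynomial f); there is a unique ℤ-algebra homomorphism ρ : H(S_n) → End_ℤ(P) with ρ(s_i) = σ_i and ρ(D_i) = ∂_i for all i; this action makes P an H(S_n)-module algebra, i.e., σ_i is a ring automorphism and ∂_i(f·g) = ∂_i(f)·g + σ_i(f)·∂_i(g) for all f, g ∈ P; and every homogeneous component of P of total degree k is invariant under ρ(H(S_n)). -/

import Mathlib

open scoped TensorProduct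

namespace HeckeHopfSn

/-- Generators of the Hecke-Hopf algebra `H(Sₙ)`: `s i` and `D i` for `i = 1, …, n-1`. -/
inductive Gen (n : ℕ) : Type
  | s : Fin (n - 1) → Gen n
  | D : Fin (n - 1) → Gen n

/-- The free `ℤ`-algebra on the generators. -/
abbrev F (n : ℕ) : Type := FreeAlgebra ℤ (Gen n)

noncomputable def fs (n : ℕ) (i : Fin (n - 1)) : F n := FreeAlgebra.ι ℤ (Gen.s i)
noncomputable def fD (n : ℕ) (i : Fin (n - 1)) : F n := FreeAlgebra.ι ℤ (Gen.D i)

/-- `|i - j| = 1`. -/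
def Adj (n : ℕ) (i j : Fin (n - 1)) : Prop := (i : ℕ) + 1 = (j : ℕ) ∨ (j : ℕ) + 1 = (i : ℕ)

/-- `|i - j| > 1`. -/
def Dist (n : ℕ) (i j : Fin (n - 1)) : Prop := (i : ℕ) + 1 < (j : ℕ) ∨ (j : ℕ) + 1 < (i : ℕ)

/-- The defining relations of `H(Sₙ)`. -/
inductive Rel (n : ℕ) : F n → F n → Prop
  | s_sq (i : Fin (n - 1)) : Rel n (fs n i * fs n i) 1
  | sD (i : Fin (n - 1)) : Rel n (fs n i * fD n i + fD n i * fs n i) (fs n i - 1)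
  | D_sq (i : Fin (n - 1)) : Rel n (fD n i * fD n i) (fD n i)
  | ss (i j : Fin (n - 1)) : Dist n i j → Rel n (fs n j * fs n i) (fs n i * fs n j)
  | Ds (i j : Fin (n - 1)) : Dist n i j → Rel n (fD n j * fs n i) (fs n i * fD n j)
  | DD (i j : Fin (n - 1)) : Dist n i j → Rel n (fD n j * fD n i) (fD n i * fD n j)
  | braid (i j : Fin (n - 1)) : Adj n i j →
      Rel n (fs n j * fs n i * fs n j) (fs n i * fs n j * fs n i)
  | braidDs (i j : Fin (n - 1)) : Adj n i j →
      Rel n (fD n i * fs n j * fs n i) (fs n j * fs n i * fD n j)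
  | braidDsD (i j : Fin (n - 1)) : Adj n i j →
      Rel n (fD n j * fs n i * fD n j)
        (fs n i * fD n j * fD n i + fD n i * fD n j * fs n i + fs n i * fD n j * fs n i)

/-- The Hecke-Hopf algebra `H(Sₙ)` of the symmetric group `Sₙ`. -/
abbrev HH (n : ℕ) : Type := RingQuot (Rel n)

/-- The image of the generator `sᵢ` in `H(Sₙ)`. -/
noncomputable def sg (n : ℕ) (i : Fin (n - 1)) : HH n := RingQuot.mkAlgHom ℤ (Rel n) (fs n i)

/-- The image of the generator `Dᵢ` in `H(Sₙ)`. -/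
noncomputable def dg (n : ℕ) (i : Fin (n - 1)) : HH n := RingQuot.mkAlgHom ℤ (Rel n) (fD n i)

/-- The element `i` of `{1, …, n}`, for `i ∈ {1, …, n-1}`. -/
def finA (n : ℕ) (i : Fin (n - 1)) : Fin n := ⟨(i : ℕ), by have h := i.2; omega⟩

/-- The element `i + 1` of `{1, …, n}`, for `i ∈ {1, …, n-1}`. -/
def finB (n : ℕ) (i : Fin (n - 1)) : Fin n := ⟨(i : ℕ) + 1, by have h := i.2; omega⟩

/-- Pairs `(i, j)` with `1 ≤ i < j ≤ n`. -/
def PairLT (n : ℕ) : Type := {p : Fin n × Fin n // p.1 < p.2}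

/-- The pair `(i, i+1)`. -/
def pairOf (n : ℕ) (i : Fin (n - 1)) : PairLT n :=
  ⟨(finA n i, finB n i), by simp [finA, finB, Fin.lt_def]⟩

/-- The automorphism of `ℤ[x₁, …, xₙ]` interchanging `xᵢ` and `xᵢ₊₁`. -/
noncomputable def sigmaP (n : ℕ) (i : Fin (n - 1)) :
    MvPolynomial (Fin n) ℤ ≃ₐ[ℤ] MvPolynomial (Fin n) ℤ :=
  MvPolynomial.renameEquiv ℤ (Equiv.swap (finA n i) (finB n i))

section Demazure

open MvPolynomial

variable {ι R : Type*} [CommRing R]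

local notation "φ" => algebraMap (MvPolynomial ι R) (FractionRing (MvPolynomial ι R))

theorem X_sub_X_ne_zero [Nontrivial R] {u v : ι} (h : u ≠ v) :
    (X v - X u : MvPolynomial ι R) ≠ 0 :=
  sub_ne_zero.2 fun e => h (X_injective e).symm

theorem _root_.MvPolynomial.IsHomogeneous.of_mul_left [IsDomain R] {f g : MvPolynomial ι R} {m k : ℕ}
    (hf : f.IsHomogeneous m) (hf0 : f ≠ 0) (hfg : (f * g).IsHomogeneous (m + k)) :
    g.IsHomogeneous k := by
  let := gradedAlgebra (σ := ι) (R := R)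
  have h := DirectSum.coe_decompose_mul_add_of_left_mem (homogeneousSubmodule ι R) (i := m) (j := k)
    (b := g) hf
  rw [DirectSum.decompose_of_mem_same _ hfg] at h
  rw [mul_left_cancel₀ hf0 h]
  exact SetLike.coe_mem (DirectSum.decompose (homogeneousSubmodule ι R) g k)

theorem algebraMap_X_sub_X_ne_zero [IsDomain R] {u v : ι} (h : u ≠ v) : φ (X v) - φ (X u) ≠ 0 := by
  rw [← map_sub]
  exact (map_ne_zero_iff _ (IsFractionRing.injective _ _)).2 (X_sub_X_ne_zero h)

variable [DecidableEq ι]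

/-- The automorphism of the polynomial ring interchanging `x_u` and `x_v`. -/
noncomputable def swapVars (R : Type*) [CommRing R] (u v : ι) :
    MvPolynomial ι R ≃ₐ[R] MvPolynomial ι R :=
  renameEquiv R (Equiv.swap u v)

theorem swapVars_X (u v k : ι) :
    swapVars R u v (X k) = X (Equiv.swap u v k) := by
  simp [swapVars]

@[simp]
theorem swapVars_X_left (u v : ι) : swapVars R u v (X u) = X v := by
  simp [swapVars_X]

@[simp]
theorem swapVars_X_right (u v : ι) : swapVars R u v (X v) = X u := by
  simp [swapVars_X]

theorem swapVars_X_of_ne {u v k : ι} (hu : k ≠ u) (hv : k ≠ v) :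
    swapVars R u v (X k) = X k := by
  rw [swapVars_X, Equiv.swap_apply_of_ne_of_ne hu hv]

@[simp]
theorem swapVars_swapVars (u v : ι) (f : MvPolynomial ι R) :
    swapVars R u v (swapVars R u v f) = f := by
  simp [swapVars, rename_rename, ← Equiv.coe_trans]

/-- Conjugating a transposition of variables by another one. -/
theorem swapVars_conj (u v a b : ι) (f : MvPolynomial ι R) :
    swapVars R u v (swapVars R a b f) =
      swapVars R (Equiv.swap u v a) (Equiv.swap u v b) (swapVars R u v f) := by
  simp only [swapVars, renameEquiv_apply, rename_rename, ← Equiv.coe_trans]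
  congr 2
  ext x
  simp [Equiv.swap_apply_apply]

theorem swapVars_commute {a b c d : ι} (hac : a ≠ c) (had : a ≠ d) (hbc : b ≠ c) (hbd : b ≠ d)
    (f : MvPolynomial ι R) :
    swapVars R a b (swapVars R c d f) = swapVars R c d (swapVars R a b f) := by
  rw [swapVars_conj, Equiv.swap_apply_of_ne_of_ne hac.symm hbc.symm,
    Equiv.swap_apply_of_ne_of_ne had.symm hbd.symm]

theorem swapVars_braid {a b c : ι} (hab : a ≠ b) (hac : a ≠ c) (hbc : b ≠ c)
    (f : MvPolynomial ι R) :
    swapVars R a b (swapVars R b c (swapVars R a b f)) =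
      swapVars R b c (swapVars R a b (swapVars R b c f)) := by
  rw [swapVars_conj a b b c, swapVars_swapVars, swapVars_conj b c a b, swapVars_swapVars,
    Equiv.swap_apply_right, Equiv.swap_apply_left, Equiv.swap_apply_of_ne_of_ne hac.symm hbc.symm,
    Equiv.swap_apply_of_ne_of_ne hab hac]

theorem sub_dvd_sub_swapVars (u v : ι) (f : MvPolynomial ι R) :
    (X v - X u) ∣ (f - swapVars R u v f) := by
  have h : (Ideal.Quotient.mkₐ R (Ideal.span {(X v - X u : MvPolynomial ι R)})) =
      (Ideal.Quotient.mkₐ R (Ideal.span {(X v - X u : MvPolynomial ι R)})).comp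
        (swapVars R u v).toAlgHom := by
    apply algHom_ext
    intro k
    change Ideal.Quotient.mk _ _ = Ideal.Quotient.mk _ (swapVars R u v (X k))
    rw [Ideal.Quotient.eq, Ideal.mem_span_singleton, swapVars_X, Equiv.swap_apply_def]
    split_ifs with h1 h2
    · exact ⟨-1, by rw [h1]; ring⟩
    · exact ⟨1, by rw [h2]; ring⟩
    · simp
  have h' := DFunLike.congr_fun h f
  change Ideal.Quotient.mk _ _ = Ideal.Quotient.mk _ (swapVars R u v f) at h'
  rwa [Ideal.Quotient.eq, Ideal.mem_span_singleton] at h'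

theorem sub_dvd_mul_sub_swapVars (u v : ι) (f : MvPolynomial ι R) :
    (X v - X u) ∣ (X v * (f - swapVars R u v f)) :=
  (sub_dvd_sub_swapVars u v f).mul_left _

theorem isHomogeneous_swapVars {u v : ι} {f : MvPolynomial ι R} {k : ℕ} (hf : f.IsHomogeneous k) :
    (swapVars R u v f).IsHomogeneous k :=
  hf.rename_isHomogeneous

variable [IsDomain R]

/-- The Demazure operator attached to two distinct variables `x_u`, `x_v`. -/
noncomputable def demazure {u v : ι} (h : u ≠ v) : MvPolynomial ι R →ₗ[R] MvPolynomial ι R where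
  toFun f := (sub_dvd_mul_sub_swapVars u v f).choose
  map_add' f g := by
    apply mul_left_cancel₀ (X_sub_X_ne_zero h)
    rw [mul_add]
    rw [← Exists.choose_spec (sub_dvd_mul_sub_swapVars u v (f + g)),
      ← Exists.choose_spec (sub_dvd_mul_sub_swapVars u v f),
      ← Exists.choose_spec (sub_dvd_mul_sub_swapVars u v g), map_add]
    ring
  map_smul' r f := by
    apply mul_left_cancel₀ (X_sub_X_ne_zero h)
    rw [mul_smul_comm, RingHom.id_apply]
    rw [← Exists.choose_spec (sub_dvd_mul_sub_swapVars u v (r • f)),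
      ← Exists.choose_spec (sub_dvd_mul_sub_swapVars u v f), map_smul,
      ← smul_sub, mul_smul_comm]

theorem sub_mul_demazure {u v : ι} (h : u ≠ v) (f : MvPolynomial ι R) :
    (X v - X u) * demazure h f = X v * (f - swapVars R u v f) :=
  (sub_dvd_mul_sub_swapVars u v f).choose_spec.symm

theorem demazure_mul {u v : ι} (h : u ≠ v) (f g : MvPolynomial ι R) :
    demazure h (f * g) = demazure h f * g + swapVars R u v f * demazure h g := by
  apply mul_left_cancel₀ (X_sub_X_ne_zero h)
  have hfg := sub_mul_demazure h (f * g)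
  rw [map_mul (swapVars R u v)] at hfg
  linear_combination hfg - g * sub_mul_demazure h f -
    swapVars R u v f * sub_mul_demazure h g

theorem isHomogeneous_demazure {u v : ι} (h : u ≠ v) {f : MvPolynomial ι R} {k : ℕ}
    (hf : f.IsHomogeneous k) : (demazure h f).IsHomogeneous k := by
  refine ((isHomogeneous_X R v).sub (isHomogeneous_X R u)).of_mul_left (X_sub_X_ne_zero h) ?_
  rw [sub_mul_demazure]
  exact (isHomogeneous_X R v).mul (hf.sub (isHomogeneous_swapVars hf))

/-- In the fraction field, the Demazure operator is a divided difference. -/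
theorem algebraMap_apply_demazure (w : MvPolynomial ι R ≃ₐ[R] MvPolynomial ι R) {u v : ι}
    (h : u ≠ v) (f : MvPolynomial ι R) :
    φ (w (demazure h f)) =
      φ (w (X v)) / (φ (w (X v)) - φ (w (X u))) * (φ (w f) - φ (w (swapVars R u v f))) := by
  have h0 : φ (w (X v)) - φ (w (X u)) ≠ 0 := by
    rw [← map_sub, ← map_sub]
    exact (map_ne_zero_iff _ (IsFractionRing.injective _ _)).2
      ((map_ne_zero_iff _ w.injective).2 (X_sub_X_ne_zero h))
  have := congr_arg (fun p => φ (w p)) (sub_mul_demazure h f)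
  simp only [map_mul, map_sub] at this
  field_simp
  linear_combination this

theorem algebraMap_demazure {u v : ι} (h : u ≠ v) (f : MvPolynomial ι R) :
    φ (demazure h f) = φ (X v) / (φ (X v) - φ (X u)) * (φ f - φ (swapVars R u v f)) :=
  algebraMap_apply_demazure AlgEquiv.refl h f

theorem algebraMap_swapVars_demazure (a b : ι) {u v : ι} (h : u ≠ v) (f : MvPolynomial ι R) :
    φ (swapVars R a b (demazure h f)) =
      φ (swapVars R a b (X v)) / (φ (swapVars R a b (X v)) - φ (swapVars R a b (X u))) *
        (φ (swapVars R a b f) - φ (swapVars R a b (swapVars R u v f))) :=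
  algebraMap_apply_demazure _ h f

theorem algebraMap_swapVars_swapVars_demazure (a b c d : ι) {u v : ι} (h : u ≠ v)
    (f : MvPolynomial ι R) :
    φ (swapVars R a b (swapVars R c d (demazure h f))) =
      φ (swapVars R a b (swapVars R c d (X v))) /
          (φ (swapVars R a b (swapVars R c d (X v))) - φ (swapVars R a b (swapVars R c d (X u)))) *
        (φ (swapVars R a b (swapVars R c d f)) -
          φ (swapVars R a b (swapVars R c d (swapVars R u v f)))) :=
  algebraMap_apply_demazure ((swapVars R c d).trans (swapVars R a b)) h f

theorem swapVars_demazure_add {u v : ι} (h : u ≠ v) (f : MvPolynomial ι R) :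
    swapVars R u v (demazure h f) + demazure h (swapVars R u v f) = swapVars R u v f - f := by
  apply IsFractionRing.injective (MvPolynomial ι R) (FractionRing (MvPolynomial ι R))
  have h1 := algebraMap_X_sub_X_ne_zero (R := R) h
  have h2 := algebraMap_X_sub_X_ne_zero (R := R) h.symm
  simp only [map_add, map_sub, algebraMap_demazure, algebraMap_swapVars_demazure,
    swapVars_X_left, swapVars_X_right, swapVars_swapVars]
  field_simp
  ring

theorem demazure_demazure {u v : ι} (h : u ≠ v) (f : MvPolynomial ι R) :
    demazure h (demazure h f) = demazure h f := by
  apply IsFractionRing.injective (MvPolynomial ι R) (FractionRing (MvPolynomial ι R))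
  have h1 := algebraMap_X_sub_X_ne_zero (R := R) h
  have h2 := algebraMap_X_sub_X_ne_zero (R := R) h.symm
  simp only [algebraMap_demazure, algebraMap_swapVars_demazure,
    swapVars_X_left, swapVars_X_right, swapVars_swapVars]
  field_simp
  ring

/-- Conjugating a Demazure operator by a transposition of variables. -/
theorem swapVars_demazure (a b : ι) {u v u' v' : ι} (h : u ≠ v) (h' : u' ≠ v')
    (hu : Equiv.swap a b u = u') (hv : Equiv.swap a b v = v') (f : MvPolynomial ι R) :
    swapVars R a b (demazure h f) = demazure h' (swapVars R a b f) := by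
  apply IsFractionRing.injective (MvPolynomial ι R) (FractionRing (MvPolynomial ι R))
  rw [algebraMap_demazure, algebraMap_swapVars_demazure, swapVars_conj a b u v, swapVars_X,
    swapVars_X, hu, hv]

theorem demazure_swapVars_commute {a b c d : ι} (hcd : c ≠ d) (hac : a ≠ c) (had : a ≠ d)
    (hbc : b ≠ c) (hbd : b ≠ d) (f : MvPolynomial ι R) :
    demazure hcd (swapVars R a b f) = swapVars R a b (demazure hcd f) :=
  (swapVars_demazure a b hcd hcd (Equiv.swap_apply_of_ne_of_ne hac.symm hbc.symm)
    (Equiv.swap_apply_of_ne_of_ne had.symm hbd.symm) f).symm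

theorem demazure_commute {a b c d : ι} (hab : a ≠ b) (hcd : c ≠ d) (hac : a ≠ c) (had : a ≠ d)
    (hbc : b ≠ c) (hbd : b ≠ d) (f : MvPolynomial ι R) :
    demazure hcd (demazure hab f) = demazure hab (demazure hcd f) := by
  apply IsFractionRing.injective (MvPolynomial ι R) (FractionRing (MvPolynomial ι R))
  simp only [algebraMap_demazure, algebraMap_swapVars_demazure,
    swapVars_X_of_ne hac had, swapVars_X_of_ne hbc hbd,
    swapVars_X_of_ne hac.symm hbc.symm, swapVars_X_of_ne had.symm hbd.symm,
    swapVars_commute hac had hbc hbd]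
  ring

theorem demazure_swapVars_swapVars_left {a b c : ι} (hab : a ≠ b) (hbc : b ≠ c)
    (hac : a ≠ c) (f : MvPolynomial ι R) :
    demazure hab (swapVars R b c (swapVars R a b f)) =
      swapVars R b c (swapVars R a b (demazure hbc f)) := by
  rw [swapVars_demazure a b hbc hac (Equiv.swap_apply_right a b)
      (Equiv.swap_apply_of_ne_of_ne hac.symm hbc.symm),
    swapVars_demazure b c hac hab (Equiv.swap_apply_of_ne_of_ne hab hac)
      (Equiv.swap_apply_right b c)]

theorem demazure_swapVars_swapVars_right {a b c : ι} (hab : a ≠ b) (hbc : b ≠ c)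
    (hac : a ≠ c) (f : MvPolynomial ι R) :
    demazure hbc (swapVars R a b (swapVars R b c f)) =
      swapVars R a b (swapVars R b c (demazure hab f)) := by
  rw [swapVars_demazure b c hab hac (Equiv.swap_apply_of_ne_of_ne hab hac)
      (Equiv.swap_apply_left b c),
    swapVars_demazure a b hac hbc (Equiv.swap_apply_left a b)
      (Equiv.swap_apply_of_ne_of_ne hac.symm hbc.symm)]

theorem demazure_swapVars_demazure_right {a b c : ι} (hab : a ≠ b) (hbc : b ≠ c)
    (hac : a ≠ c) (f : MvPolynomial ι R) :
    demazure hbc (swapVars R a b (demazure hbc f)) =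
      swapVars R a b (demazure hbc (demazure hab f)) +
        demazure hab (demazure hbc (swapVars R a b f)) +
        swapVars R a b (demazure hbc (swapVars R a b f)) := by
  apply IsFractionRing.injective (MvPolynomial ι R) (FractionRing (MvPolynomial ι R))
  have h1 := algebraMap_X_sub_X_ne_zero (R := R) hab
  have h2 := algebraMap_X_sub_X_ne_zero (R := R) hbc
  have h3 := algebraMap_X_sub_X_ne_zero (R := R) hac
  have h4 := algebraMap_X_sub_X_ne_zero (R := R) hab.symm
  simp only [map_add, algebraMap_demazure, algebraMap_swapVars_demazure,
    algebraMap_swapVars_swapVars_demazure, swapVars_X_left, swapVars_X_right, swapVars_swapVars,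
    swapVars_X_of_ne hac.symm hbc.symm, swapVars_X_of_ne hab hac, ← swapVars_braid hab hac hbc]
  field_simp
  ring

theorem demazure_swapVars_demazure_left {a b c : ι} (hab : a ≠ b) (hbc : b ≠ c)
    (hac : a ≠ c) (f : MvPolynomial ι R) :
    demazure hab (swapVars R b c (demazure hab f)) =
      swapVars R b c (demazure hab (demazure hbc f)) +
        demazure hbc (demazure hab (swapVars R b c f)) +
        swapVars R b c (demazure hab (swapVars R b c f)) := by
  apply IsFractionRing.injective (MvPolynomial ι R) (FractionRing (MvPolynomial ι R))
  have h1 := algebraMap_X_sub_X_ne_zero (R := R) hab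
  have h2 := algebraMap_X_sub_X_ne_zero (R := R) hbc
  have h3 := algebraMap_X_sub_X_ne_zero (R := R) hac
  have h4 := algebraMap_X_sub_X_ne_zero (R := R) hbc.symm
  simp only [map_add, algebraMap_demazure, algebraMap_swapVars_demazure,
    algebraMap_swapVars_swapVars_demazure, swapVars_X_left, swapVars_X_right, swapVars_swapVars,
    swapVars_X_of_ne hac.symm hbc.symm, swapVars_X_of_ne hab hac, swapVars_braid hab hac hbc]
  field_simp
  ring

end Demazure

section Action

theorem finA_ne_finB {n : ℕ} (i : Fin (n - 1)) : finA n i ≠ finB n i := by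
  simp [finA, finB]

/-- The Demazure operator `∂ᵢ`. -/
noncomputable def demOp (n : ℕ) (i : Fin (n - 1)) : Module.End ℤ (MvPolynomial (Fin n) ℤ) :=
  demazure (finA_ne_finB i)

/-- The images of the generators of `H(Sₙ)` in `End_ℤ(P)`. -/
noncomputable def genAction (n : ℕ) : Gen n → Module.End ℤ (MvPolynomial (Fin n) ℤ)
  | Gen.s i => (sigmaP n i).toLinearMap
  | Gen.D i => demOp n i

theorem lift_fs (n : ℕ) (i : Fin (n - 1)) (f : MvPolynomial (Fin n) ℤ) :
    FreeAlgebra.lift ℤ (genAction n) (fs n i) f = swapVars ℤ (finA n i) (finB n i) f := by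
  rw [fs, FreeAlgebra.lift_ι_apply]
  rfl

theorem lift_fD (n : ℕ) (i : Fin (n - 1)) (f : MvPolynomial (Fin n) ℤ) :
    FreeAlgebra.lift ℤ (genAction n) (fD n i) f = demazure (finA_ne_finB i) f := by
  rw [fD, FreeAlgebra.lift_ι_apply]
  rfl

theorem Dist.ne {n : ℕ} {i j : Fin (n - 1)} (h : Dist n i j) :
    finA n i ≠ finA n j ∧ finA n i ≠ finB n j ∧ finB n i ≠ finA n j ∧ finB n i ≠ finB n j := by
  unfold Dist at h
  simp only [finA, finB, ne_eq, Fin.mk.injEq]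
  omega

theorem Adj.exists_eq {n : ℕ} {i j : Fin (n - 1)} (h : Adj n i j) :
    (finB n i = finA n j ∧ finA n i ≠ finB n j) ∨ (finB n j = finA n i ∧ finA n j ≠ finB n i) := by
  unfold Adj at h
  simp only [finA, finB, ne_eq, Fin.mk.injEq]
  omega

theorem lift_genAction_rel (n : ℕ) ⦃x y : F n⦄ (h : Rel n x y) :
    FreeAlgebra.lift ℤ (genAction n) x = FreeAlgebra.lift ℤ (genAction n) y := by
  refine LinearMap.ext fun f => ?_
  cases h with
  | s_sq i => simp [lift_fs]
  | sD i => simp [lift_fs, lift_fD, swapVars_demazure_add]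
  | D_sq i => simp [lift_fD, demazure_demazure]
  | ss i j h =>
    obtain ⟨h1, h2, h3, h4⟩ := h.ne
    simp [lift_fs, swapVars_commute h1 h2 h3 h4]
  | Ds i j h =>
    obtain ⟨h1, h2, h3, h4⟩ := h.ne
    simp [lift_fs, lift_fD, demazure_swapVars_commute _ h1 h2 h3 h4]
  | DD i j h =>
    obtain ⟨h1, h2, h3, h4⟩ := h.ne
    simp [lift_fD, demazure_commute _ _ h1 h2 h3 h4]
  | braid i j h =>
    have hi := finA_ne_finB i
    have hj := finA_ne_finB j
    simp only [map_mul, Module.End.mul_apply, lift_fs]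
    obtain ⟨e, hne⟩ | ⟨e, hne⟩ := h.exists_eq
    · rw [← e] at hj ⊢
      exact (swapVars_braid hi hne hj f).symm
    · rw [← e] at hi ⊢
      exact swapVars_braid hj hne hi f
  | braidDs i j h =>
    have hi := finA_ne_finB i
    have hj := finA_ne_finB j
    simp only [map_mul, Module.End.mul_apply, lift_fs, lift_fD]
    obtain ⟨e, hne⟩ | ⟨e, hne⟩ := h.exists_eq
    · simp only [← e] at hj ⊢
      exact demazure_swapVars_swapVars_left hi hj hne f
    · simp only [← e] at hi ⊢
      exact demazure_swapVars_swapVars_right hj hi hne f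
  | braidDsD i j h =>
    have hi := finA_ne_finB i
    have hj := finA_ne_finB j
    simp only [map_add, map_mul, LinearMap.add_apply, Module.End.mul_apply, lift_fs, lift_fD]
    obtain ⟨e, hne⟩ | ⟨e, hne⟩ := h.exists_eq
    · simp only [← e] at hj ⊢
      exact demazure_swapVars_demazure_right hi hj hne f
    · simp only [← e] at hi ⊢
      exact demazure_swapVars_demazure_left hj hi hne f

/-- The action of `H(Sₙ)` on `ℤ[x₁, …, xₙ]`. -/
noncomputable def action (n : ℕ) : HH n →ₐ[ℤ] Module.End ℤ (MvPolynomial (Fin n) ℤ) :=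
  RingQuot.liftAlgHom ℤ ⟨FreeAlgebra.lift ℤ (genAction n), lift_genAction_rel n⟩

theorem action_sg (n : ℕ) (i : Fin (n - 1)) : action n (sg n i) = (sigmaP n i).toLinearMap := by
  rw [action, sg, RingQuot.liftAlgHom_mkAlgHom_apply, fs, FreeAlgebra.lift_ι_apply, genAction]

theorem action_dg (n : ℕ) (i : Fin (n - 1)) : action n (dg n i) = demOp n i := by
  rw [action, dg, RingQuot.liftAlgHom_mkAlgHom_apply, fD, FreeAlgebra.lift_ι_apply, genAction]

theorem HH.algHom_ext {n : ℕ} {A : Type*} [Ring A] {ρ τ : HH n →ₐ[ℤ] A}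
    (hs : ∀ i, ρ (sg n i) = τ (sg n i)) (hD : ∀ i, ρ (dg n i) = τ (dg n i)) : ρ = τ := by
  apply RingQuot.ringQuot_ext'
  apply FreeAlgebra.hom_ext
  ext (i | i)
  · exact hs i
  · exact hD i

theorem HH.mem_of_generators {n : ℕ} (S : Subalgebra ℤ (HH n)) (hs : ∀ i, sg n i ∈ S)
    (hD : ∀ i, dg n i ∈ S) (h : HH n) : h ∈ S := by
  obtain ⟨x, rfl⟩ := RingQuot.mkAlgHom_surjective ℤ (Rel n) h
  induction x using FreeAlgebra.induction with
  | grade0 r => rw [AlgHom.commutes]; exact S.algebraMap_mem r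
  | grade1 x =>
    cases x with
    | s i => exact hs i
    | D i => exact hD i
  | mul a b ha hb => rw [map_mul]; exact S.mul_mem ha hb
  | add a b ha hb => rw [map_add]; exact S.add_mem ha hb

/-- The endomorphisms of a module preserving a given submodule. -/
def stabilizerSubalgebra {R M : Type*} [CommRing R] [AddCommGroup M] [Module R M]
    (N : Submodule R M) : Subalgebra R (Module.End R M) where
  carrier := {φ | ∀ f ∈ N, φ f ∈ N}
  mul_mem' hφ hψ f hf := hφ _ (hψ f hf)
  add_mem' hφ hψ f hf := N.add_mem (hφ f hf) (hψ f hf)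
  algebraMap_mem' r _ hf := N.smul_mem r hf

end Action

open MvPolynomial in
/-- For every `n ≥ 2`: the Demazure operators `∂ᵢ`, determined by
`(x_{i+1} - x_i)·∂ᵢ(f) = x_{i+1}·(f - σᵢ(f))`, are well-defined `ℤ`-linear endomorphisms of
`P = ℤ[x₁, …, xₙ]`; they satisfy the twisted Leibniz rule
`∂ᵢ(f·g) = ∂ᵢ(f)·g + σᵢ(f)·∂ᵢ(g)`; there is a unique `ℤ`-algebra homomorphism
`ρ : H(Sₙ) → End_ℤ(P)` with `ρ(sᵢ) = σᵢ`, `ρ(Dᵢ) = ∂ᵢ`; and each homogeneous component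
of `P` is invariant under `ρ(H(Sₙ))`. -/
theorem demazure_action (n : ℕ) (hn : 2 ≤ n) :
    (∀ (i : Fin (n - 1)) (f : MvPolynomial (Fin n) ℤ),
      (X (finB n i) - X (finA n i)) ∣ (X (finB n i) * (f - sigmaP n i f))) ∧
    ∃ dem : Fin (n - 1) → (MvPolynomial (Fin n) ℤ →ₗ[ℤ] MvPolynomial (Fin n) ℤ),
      (∀ (i : Fin (n - 1)) (f : MvPolynomial (Fin n) ℤ),
        (X (finB n i) - X (finA n i)) * dem i f = X (finB n i) * (f - sigmaP n i f)) ∧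
      (∀ (i : Fin (n - 1)) (f g : MvPolynomial (Fin n) ℤ),
        dem i (f * g) = dem i f * g + sigmaP n i f * dem i g) ∧
      (∃! ρ : HH n →ₐ[ℤ] Module.End ℤ (MvPolynomial (Fin n) ℤ),
        (∀ i : Fin (n - 1), ρ (sg n i) = (sigmaP n i).toLinearMap) ∧
        (∀ i : Fin (n - 1), ρ (dg n i) = dem i)) ∧
      (∀ ρ : HH n →ₐ[ℤ] Module.End ℤ (MvPolynomial (Fin n) ℤ),
        ((∀ i : Fin (n - 1), ρ (sg n i) = (sigmaP n i).toLinearMap) ∧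
         (∀ i : Fin (n - 1), ρ (dg n i) = dem i)) →
        ∀ (k : ℕ) (h : HH n) (f : MvPolynomial (Fin n) ℤ),
          f ∈ MvPolynomial.homogeneousSubmodule (Fin n) ℤ k →
            ρ h f ∈ MvPolynomial.homogeneousSubmodule (Fin n) ℤ k) := by
  refine ⟨fun i f => sub_dvd_mul_sub_swapVars _ _ f, demOp n,
    fun i f => sub_mul_demazure (finA_ne_finB i) f, fun i f g => demazure_mul (finA_ne_finB i) f g,
    ⟨action n, ⟨action_sg n, action_dg n⟩, fun ρ hρ => HH.algHom_ext
      (fun i => (hρ.1 i).trans (action_sg n i).symm)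
      (fun i => (hρ.2 i).trans (action_dg n i).symm)⟩, ?_⟩
  rintro ρ ⟨hs, hD⟩ k h f hf
  refine HH.mem_of_generators ((stabilizerSubalgebra (homogeneousSubmodule (Fin n) ℤ k)).comap ρ)
    (fun i => ?_) (fun i => ?_) h f hf
  · rw [Subalgebra.mem_comap, hs]
    exact fun g hg => isHomogeneous_swapVars hg
  · rw [Subalgebra.mem_comap, hD]
    exact fun g hg => isHomogeneous_demazure (finA_ne_finB i) hg

end HeckeHopfSn
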